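/- arXiv:2603.02289 — 3 statements merged into one kernel-verified Lean document; each statement's English description precedes it below -/
import Mathlib

section
/- (T2a bound in the silhouette stability proof.) Let (p_i)_{i=1}^N and (p′_i)_{i=1}^N be families of pairs of real numbers with a_i < b_i and a′_i < b′_i, let r ≥ 1, set w_i = (b_i − a_i)^r, w′_i = (b′_i − a′_i)^r, S = Σ_i w_i > 0, S′ = Σ_i w′_i > 0, let c = max over all i of max(b_i − a_i, b′_i − a′_i), and suppose (b′_i − a′_i)/(b′_i − a′_i)^r ≤ L for all i. Then Σ_i ((b′_i − a′_i)/2) · (|S′ − S| · w_i)/(S S′) ≤ L r c^{r−1} Σ_j ‖p_j − p′_j‖∞. -/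
theorem rpow_diff_aux {x y c r : ℝ} (hy : 0 < y) (hyx : y ≤ x) (hxc : x ≤ c) (hr : 1 ≤ r) :
    x ^ r - y ^ r ≤ r * c ^ (r - 1) * (x - y) := by
  have hx : 0 < x := hy.trans_le hyx
  have h1 := one_add_mul_self_le_rpow_one_add (s := y / x - 1)
    (by have : 0 < y / x := by positivity
        linarith) hr
  rw [show 1 + (y / x - 1) = y / x by ring, Real.div_rpow hy.le hx.le] at h1
  have hxr : 0 < x ^ r := Real.rpow_pos_of_pos hx r
  rw [le_div_iff₀ hxr] at h1
  have h2 : x ^ r = x ^ (r - 1) * x := by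
    rw [Real.rpow_sub_one hx.ne']; field_simp
  have h3 : (1 + r * (y / x - 1)) * x ^ r = x ^ r - r * x ^ (r - 1) * (x - y) := by
    rw [h2]; field_simp; ring
  have h4 : x ^ (r - 1) ≤ c ^ (r - 1) := Real.rpow_le_rpow hx.le hxc (by linarith)
  have h5 : r * x ^ (r - 1) * (x - y) ≤ r * c ^ (r - 1) * (x - y) :=
    mul_le_mul_of_nonneg_right (mul_le_mul_of_nonneg_left h4 (by linarith)) (by linarith)
  linarith

theorem abs_rpow_diff_aux {x y c r : ℝ} (hx : 0 < x) (hy : 0 < y) (hxc : x ≤ c) (hyc : y ≤ c)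
    (hr : 1 ≤ r) : |x ^ r - y ^ r| ≤ r * c ^ (r - 1) * |x - y| := by
  rcases le_total y x with h | h
  · rw [abs_of_nonneg (sub_nonneg.2 (Real.rpow_le_rpow hy.le h (by linarith))),
      abs_of_nonneg (sub_nonneg.2 h)]
    exact rpow_diff_aux hy h hxc hr
  · rw [abs_sub_comm, abs_sub_comm x y,
      abs_of_nonneg (sub_nonneg.2 (Real.rpow_le_rpow hx.le h (by linarith))),
      abs_of_nonneg (sub_nonneg.2 h)]
    exact rpow_diff_aux hx h hyc hr

/-- T2a bound in the silhouette stability proof. With power weights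
`w_i = (b_i − a_i)^r`, `w'_i = (b'_i − a'_i)^r`, totals `S`, `S'`,
`c` the maximum over all `i` of `max(b_i − a_i, b'_i − a'_i)`, and the ratio bound
`(b'_i − a'_i)/(b'_i − a'_i)^r ≤ L`, one has
`Σ_i ((b'_i − a'_i)/2) · (|S' − S| w_i)/(S S') ≤ L r c^{r−1} Σ_j ‖p_j − p'_j‖∞`. -/
theorem T2a_bound (N : ℕ) (a b a' b' : Fin N → ℝ)
    (hab : ∀ i, a i < b i) (hab' : ∀ i, a' i < b' i) (r : ℝ) (hr : 1 ≤ r)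
    (S S' : ℝ) (hSdef : S = ∑ i, (b i - a i) ^ r) (hS'def : S' = ∑ i, (b' i - a' i) ^ r)
    (hSpos : 0 < S) (hS'pos : 0 < S')
    (c : ℝ) (hc : c = ⨆ i, max (b i - a i) (b' i - a' i))
    (L : ℝ) (hL : ∀ i, (b' i - a' i) / (b' i - a' i) ^ r ≤ L) :
    (∑ i, (b' i - a' i) / 2 * (|S' - S| * (b i - a i) ^ r) / (S * S')) ≤
      L * r * c ^ (r - 1) * ∑ j, max |a j - a' j| |b j - b' j| := by
  have hw : ∀ i, 0 < (b i - a i) ^ r := fun i => Real.rpow_pos_of_pos (sub_pos.2 (hab i)) r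
  have hw' : ∀ i, 0 < (b' i - a' i) ^ r := fun i => Real.rpow_pos_of_pos (sub_pos.2 (hab' i)) r
  have hcm : ∀ i, max (b i - a i) (b' i - a' i) ≤ c := fun i => by
    rw [hc]
    exact le_ciSup (f := fun i => max (b i - a i) (b' i - a' i)) (Set.finite_range _).bddAbove i
  have hN : Nonempty (Fin N) := by
    by_contra h
    rw [not_nonempty_iff] at h
    simp at hSdef
    linarith
  obtain ⟨i0⟩ := hN
  have hL0 : 0 ≤ L := le_trans (div_nonneg (sub_pos.2 (hab' i0)).le (hw' i0).le) (hL i0)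
  have hdiff : |S' - S| ≤ 2 * (r * c ^ (r - 1) * ∑ j, max |a j - a' j| |b j - b' j|) := by
    rw [hSdef, hS'def, ← Finset.sum_sub_distrib, Finset.mul_sum, Finset.mul_sum]
    refine (Finset.abs_sum_le_sum_abs _ _).trans (Finset.sum_le_sum fun i _ => ?_)
    have hbase := abs_rpow_diff_aux (sub_pos.2 (hab' i)) (sub_pos.2 (hab i))
      ((le_max_right _ _).trans (hcm i)) ((le_max_left _ _).trans (hcm i)) hr
    have hc0 : 0 < c := (sub_pos.2 (hab i)).trans_le ((le_max_left _ _).trans (hcm i))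
    have hk : 0 ≤ r * c ^ (r - 1) :=
      mul_nonneg (by linarith) (Real.rpow_pos_of_pos hc0 _).le
    have htri : |(b' i - a' i) - (b i - a i)| ≤ 2 * max |a i - a' i| |b i - b' i| := by
      have e1 := le_max_left |a i - a' i| |b i - b' i|
      have e2 := le_max_right |a i - a' i| |b i - b' i|
      have e3 := abs_sub (a i - a' i) (b i - b' i)
      rw [show (b' i - a' i) - (b i - a i) = (a i - a' i) - (b i - b' i) by ring]
      linarith
    have := mul_le_mul_of_nonneg_left htri hk
    linarith
  have hmain : (∑ i, (b' i - a' i) / 2 * (|S' - S| * (b i - a i) ^ r) / (S * S')) ≤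
      ∑ i, (L * |S' - S| / 2 / S') * (b' i - a' i) ^ r := by
    refine Finset.sum_le_sum fun i _ => ?_
    have h1 : b' i - a' i ≤ L * (b' i - a' i) ^ r := (div_le_iff₀ (hw' i)).1 (hL i)
    have h2 : (b i - a i) ^ r ≤ S := by
      rw [hSdef]
      exact Finset.single_le_sum (f := fun i => (b i - a i) ^ r)
        (fun j _ => (hw j).le) (Finset.mem_univ i)
    rw [div_le_iff₀ (mul_pos hSpos hS'pos)]
    have h3 : (b' i - a' i) * (b i - a i) ^ r ≤ L * (b' i - a' i) ^ r * S :=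
      mul_le_mul h1 h2 (hw i).le (mul_nonneg hL0 (hw' i).le)
    have h4 := mul_le_mul_of_nonneg_left h3 
      (div_nonneg (abs_nonneg (S' - S)) zero_le_two)
    have h5 : L * |S' - S| / 2 / S' * (b' i - a' i) ^ r * (S * S') =
        |S' - S| / 2 * (L * (b' i - a' i) ^ r * S) := by
      field_simp
    rw [h5]
    linarith
  rw [← Finset.mul_sum, ← hS'def, div_mul_cancel₀ _ hS'pos.ne'] at hmain
  have := mul_le_mul_of_nonneg_left hdiff hL0
  linarith
end

section
/- (T2b bound in the silhouette stability proof.) Let (p_i)_{i=1}^N and (p′_i)_{i=1}^N be families of pairs of real numbers with a_i < b_i and a′_i < b′_i, let r ≥ 1, set w_i = (b_i − a_i)^r, w′_i = (b′_i − a′_i)^r, S′ = Σ_i w′_i > 0, let c = max over all i of max(b_i − a_i, b′_i − a′_i), and suppose (b′_i − a′_i)/(b′_i − a′_i)^r ≤ L for all i. Then Σ_i ((b′_i − a′_i)/2) · |w_i − w′_i| / S′ ≤ L r c^{r−1} Σ_j ‖p_j − p′_j‖∞. -/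
lemma rpow_lip (r c x y : ℝ) (hr : 1 ≤ r) (hx : 0 < x) (hy : 0 < y) (hxc : x ≤ c) (hyc : y ≤ c) :
    |x ^ r - y ^ r| ≤ r * c ^ (r - 1) * |x - y| := by
  have h := Convex.norm_image_sub_le_of_norm_hasDerivWithin_le (𝕜 := ℝ)
    (f := fun t : ℝ => t ^ r) (f' := fun t => r * t ^ (r - 1)) (s := Set.Icc 0 c)
    (C := r * c ^ (r - 1)) (x := y) (y := x)
    (fun t _ => (Real.hasDerivAt_rpow_const (Or.inr hr)).hasDerivWithinAt)
    (fun t ht => by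
      have h0 : 0 ≤ t ^ (r - 1) := Real.rpow_nonneg ht.1 _
      rw [Real.norm_eq_abs, abs_of_nonneg (by positivity)]
      have := Real.rpow_le_rpow ht.1 ht.2 (by linarith : 0 ≤ r - 1)
      gcongr)
    (convex_Icc 0 c) ⟨hy.le, hyc⟩ ⟨hx.le, hxc⟩
  simpa [Real.norm_eq_abs] using h


/-- T2b bound in the silhouette stability proof. With power weights
`w_i = (b_i − a_i)^r`, `w'_i = (b'_i − a'_i)^r`, total `S' = Σ_i w'_i > 0`,
`c` the maximum over all `i` of `max(b_i − a_i, b'_i − a'_i)`, and the ratio bound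
`(b'_i − a'_i)/(b'_i − a'_i)^r ≤ L`, one has
`Σ_i ((b'_i − a'_i)/2) · |w_i − w'_i| / S' ≤ L r c^{r−1} Σ_j ‖p_j − p'_j‖∞`. -/
theorem T2b_bound (N : ℕ) (a b a' b' : Fin N → ℝ)
    (hab : ∀ i, a i < b i) (hab' : ∀ i, a' i < b' i) (r : ℝ) (hr : 1 ≤ r)
    (S' : ℝ) (hS'def : S' = ∑ i, (b' i - a' i) ^ r) (hS'pos : 0 < S')
    (c : ℝ) (hc : c = ⨆ i, max (b i - a i) (b' i - a' i))
    (L : ℝ) (hL : ∀ i, (b' i - a' i) / (b' i - a' i) ^ r ≤ L) :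
    (∑ i, (b' i - a' i) / 2 * |(b i - a i) ^ r - (b' i - a' i) ^ r| / S') ≤
      L * r * c ^ (r - 1) * ∑ j, max |a j - a' j| |b j - b' j| := by
  rw [Finset.mul_sum]
  apply Finset.sum_le_sum
  intro i _
  have hle : max (b i - a i) (b' i - a' i) ≤ c := by
    rw [hc]
    exact le_ciSup (f := fun i => max (b i - a i) (b' i - a' i)) (Set.finite_range _).bddAbove i
  have hx : 0 < b i - a i := sub_pos.2 (hab i)
  have hy : 0 < b' i - a' i := sub_pos.2 (hab' i)
  have h1 := rpow_lip r c _ _ hr hx hy ((le_max_left _ _).trans hle) ((le_max_right _ _).trans hle)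
  have hc0 : 0 ≤ c := hx.le.trans ((le_max_left _ _).trans hle)
  have hcp : 0 ≤ c ^ (r - 1) := Real.rpow_nonneg hc0 _
  have hw : 0 < (b' i - a' i) ^ r := Real.rpow_pos_of_pos hy r
  have hwS : (b' i - a' i) ^ r ≤ S' := by
    rw [hS'def]
    exact Finset.single_le_sum (f := fun i => (b' i - a' i) ^ r)
      (fun j _ => Real.rpow_nonneg (sub_pos.2 (hab' j)).le r) (Finset.mem_univ i)
  have h2 : |b i - a i - (b' i - a' i)| ≤ 2 * max |a i - a' i| |b i - b' i| := by
    have e : b i - a i - (b' i - a' i) = (b i - b' i) - (a i - a' i) := by ring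
    rw [e]
    have := abs_sub (b i - b' i) (a i - a' i)
    have := le_max_left |a i - a' i| |b i - b' i|
    have := le_max_right |a i - a' i| |b i - b' i|
    linarith
  have h3 : (b' i - a' i) / S' ≤ L := (div_le_div_of_nonneg_left hy.le hw hwS).trans (hL i)
  have hL0 : 0 ≤ L := (div_nonneg hy.le hw.le).trans (hL i)
  have h4 : |(b i - a i) ^ r - (b' i - a' i) ^ r| ≤
      r * c ^ (r - 1) * (2 * max |a i - a' i| |b i - b' i|) :=
    h1.trans (mul_le_mul_of_nonneg_left h2 (by positivity))
  calc (b' i - a' i) / 2 * |(b i - a i) ^ r - (b' i - a' i) ^ r| / S'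
      = (b' i - a' i) / S' * |(b i - a i) ^ r - (b' i - a' i) ^ r| / 2 := by ring
    _ ≤ L * (r * c ^ (r - 1) * (2 * max |a i - a' i| |b i - b' i|)) / 2 := by
        gcongr
    _ = _ := by ring
end

section
/- (Theorem 3, special case r = 1.) Let (p_i)_{i=1}^N and (p′_i)_{i=1}^N be two families of pairs p_i = (a_i, b_i), p′_i = (a′_i, b′_i) of real numbers with a_i < b_i and a′_i < b′_i, set w_i = b_i − a_i and w′_i = b′_i − a′_i (so Σ_i w_i > 0 and Σ_i w′_i > 0), and let φ(t) = (Σ_i w_i Λ_{p_i}(t))/(Σ_i w_i) and φ′(t) = (Σ_i w′_i Λ_{p′_i}(t))/(Σ_i w′_i). Then for all t ∈ ℝ, |φ(t) − φ′(t)| ≤ 3 Σ_i ‖p_i − p′_i‖∞. -/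
/-- The tent function of a persistence pair `p = (a, b)`. -/
noncomputable def tent (a b t : ℝ) : ℝ := max 0 (min (t - a) (b - t))

lemma tent_nonneg (a b t : ℝ) : 0 ≤ tent a b t := le_max_left _ _

lemma tent_le_half (a b t : ℝ) (h : a < b) : tent a b t ≤ (b - a) / 2 := by
  unfold tent
  refine max_le (by linarith) ?_
  rcases le_total (t - a) (b - t) with h1 | h1
  · rw [min_eq_left h1]; linarith
  · rw [min_eq_right h1]; linarith

lemma tent_sub_le (a b a' b' t : ℝ) :
    |tent a b t - tent a' b' t| ≤ max |a - a'| |b - b'| := by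
  unfold tent
  have h1 := abs_max_sub_max_le_max 0 (min (t - a) (b - t)) 0 (min (t - a') (b' - t))
  have h2 := abs_min_sub_min_le_max (t - a) (b - t) (t - a') (b' - t)
  have e1 : |t - a - (t - a')| = |a - a'| := by
    rw [abs_sub_comm a a']; congr 1; ring
  have e2 : |b - t - (b' - t)| = |b - b'| := by congr 1; ring
  rw [e1, e2] at h2
  refine h1.trans (max_le ?_ h2)
  simp

lemma silhouette_aux (N : ℕ) (hN : 0 < N) (a b a' b' : Fin N → ℝ)
    (hab : ∀ i, a i < b i) (hab' : ∀ i, a' i < b' i) (t : ℝ)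
    (hW : ∑ i, (b' i - a' i) ≤ ∑ i, (b i - a i)) :
    |(∑ i, (b i - a i) * tent (a i) (b i) t) / (∑ i, (b i - a i)) -
        (∑ i, (b' i - a' i) * tent (a' i) (b' i) t) / (∑ i, (b' i - a' i))| ≤
      2 * ∑ i, max |a i - a' i| |b i - b' i| := by
  have hne : (Finset.univ : Finset (Fin N)).Nonempty := ⟨⟨0, hN⟩, Finset.mem_univ _⟩
  have hWpos : 0 < ∑ i, (b i - a i) :=
    Finset.sum_pos (fun i _ => sub_pos.2 (hab i)) hne
  have hWpos' : 0 < ∑ i, (b' i - a' i) :=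
    Finset.sum_pos (fun i _ => sub_pos.2 (hab' i)) hne
  have hw : ∀ i, b i - a i ≤ ∑ i, (b i - a i) := fun i =>
    Finset.single_le_sum (f := fun i => b i - a i)
      (fun j _ => (sub_pos.2 (hab j)).le) (Finset.mem_univ i)
  have hw' : ∀ i, b' i - a' i ≤ ∑ i, (b' i - a' i) := fun i =>
    Finset.single_le_sum (f := fun i => b' i - a' i)
      (fun j _ => (sub_pos.2 (hab' j)).le) (Finset.mem_univ i)
  have hL : ∀ i, tent (a' i) (b' i) t ≤ (∑ i, (b' i - a' i)) / 2 := fun i => by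
    linarith [tent_le_half (a' i) (b' i) t (hab' i), hw' i]
  have hS0 : 0 ≤ ∑ i, (b' i - a' i) * tent (a' i) (b' i) t :=
    Finset.sum_nonneg fun i _ => mul_nonneg (sub_pos.2 (hab' i)).le (tent_nonneg _ _ _)
  have hS1 : ∑ i, (b' i - a' i) * tent (a' i) (b' i) t ≤
      (∑ i, (b' i - a' i)) * ((∑ i, (b' i - a' i)) / 2) := by
    rw [Finset.sum_mul]
    exact Finset.sum_le_sum fun i _ =>
      mul_le_mul_of_nonneg_left (hL i) (sub_pos.2 (hab' i)).le
  set W := ∑ i, (b i - a i) with hWd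
  set W' := ∑ i, (b' i - a' i) with hWd'
  set S' := ∑ i, (b' i - a' i) * tent (a' i) (b' i) t with hSd
  obtain ⟨p, hp⟩ : ∃ p, p = S' / W' := ⟨_, rfl⟩
  have hpS : p * W' = S' := by rw [hp]; field_simp
  have hp0 : 0 ≤ p := by rw [hp]; positivity
  have hp1 : p ≤ W' / 2 := by rw [hp, div_le_iff₀ hWpos']; linarith
  rw [← hp]
  have key : (∑ i, (b i - a i) * tent (a i) (b i) t) / W - p =
      (∑ i, ((b i - a i) * (tent (a i) (b i) t - tent (a' i) (b' i) t) +
        (tent (a' i) (b' i) t - p) * ((b i - a i) - (b' i - a' i)))) / W := by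
    have : ∑ i, ((b i - a i) * (tent (a i) (b i) t - tent (a' i) (b' i) t) +
        (tent (a' i) (b' i) t - p) * ((b i - a i) - (b' i - a' i))) =
        ∑ i, (b i - a i) * tent (a i) (b i) t - S' - p * W + p * W' := by
      rw [hSd, hWd, hWd', Finset.mul_sum, Finset.mul_sum, ← Finset.sum_sub_distrib,
        ← Finset.sum_sub_distrib, ← Finset.sum_add_distrib]
      exact Finset.sum_congr rfl fun i _ => by ring
    rw [this, hpS]
    field_simp
    ring
  rw [key, abs_div, abs_of_pos hWpos, div_le_iff₀ hWpos]
  refine (Finset.abs_sum_le_sum_abs _ _).trans ?_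
  rw [mul_comm 2, mul_assoc, Finset.sum_mul]
  refine Finset.sum_le_sum fun i _ => ?_
  have ht := tent_sub_le (a i) (b i) (a' i) (b' i) t
  have hda := le_max_left |a i - a' i| |b i - b' i|
  have hdb := le_max_right |a i - a' i| |b i - b' i|
  set d := max |a i - a' i| |b i - b' i|
  have hd0 : 0 ≤ d := (abs_nonneg _).trans hda
  have h1 : |(b i - a i) * (tent (a i) (b i) t - tent (a' i) (b' i) t)| ≤ W * d := by
    rw [abs_mul, abs_of_pos (sub_pos.2 (hab i))]
    exact mul_le_mul (hw i) ht (abs_nonneg _) hWpos.le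
  have h2 : |(tent (a' i) (b' i) t - p) * ((b i - a i) - (b' i - a' i))| ≤ W / 2 * (2 * d) := by
    rw [abs_mul]
    refine mul_le_mul ?_ ?_ (abs_nonneg _) (by positivity)
    · rw [abs_le]
      constructor <;> linarith [hL i, tent_nonneg (a' i) (b' i) t]
    · have := abs_le.1 hda
      have := abs_le.1 hdb
      rw [abs_le]
      constructor <;> linarith
  refine (abs_add_le _ _).trans ?_
  linarith

/-- Theorem 3, special case `r = 1`: with weights `w_i = b_i − a_i`,
`w'_i = b'_i − a'_i` (which have positive total sums since the families are
nonempty and `a_i < b_i`, `a'_i < b'_i`), the corresponding silhouettes satisfy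
`|φ(t) − φ'(t)| ≤ 3 Σ_i ‖p_i − p'_i‖∞` for all `t`. -/
theorem silhouette_stability_r_one (N : ℕ) (hN : 0 < N) (a b a' b' : Fin N → ℝ)
    (hab : ∀ i, a i < b i) (hab' : ∀ i, a' i < b' i) (t : ℝ) :
    |(∑ i, (b i - a i) * tent (a i) (b i) t) / (∑ i, (b i - a i)) -
        (∑ i, (b' i - a' i) * tent (a' i) (b' i) t) / (∑ i, (b' i - a' i))| ≤
      3 * ∑ i, max |a i - a' i| |b i - b' i| := by
  have hD : 0 ≤ ∑ i, max |a i - a' i| |b i - b' i| :=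
    Finset.sum_nonneg fun i _ => (abs_nonneg _).trans (le_max_left _ _)
  rcases le_total (∑ i, (b' i - a' i)) (∑ i, (b i - a i)) with h | h
  · linarith [silhouette_aux N hN a b a' b' hab hab' t h]
  · have h1 := silhouette_aux N hN a' b' a b hab' hab t h
    rw [abs_sub_comm] at h1
    have h2 : ∑ i, max |a' i - a i| |b' i - b i| = ∑ i, max |a i - a' i| |b i - b' i| :=
      Finset.sum_congr rfl fun i _ => by rw [abs_sub_comm (a' i), abs_sub_comm (b' i)]
    rw [h2] at h1
    linarith
end
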